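/- arXiv:2110.11928 — 5 statements merged into one kernel-verified Lean document; each statement's English description precedes it below -/
import Mathlib

section
/- Let x ∈ X and a_0, …, a_r ∈ X satisfy Σ_{j=0}^{r} d(x, a_j) < (r+1)·ε'. If b_j ∈ q_A(a_j) for each j = 0, …, r, then Σ_{j=0}^{r} d(x, b_j) < (r+1)·(ε+γ)/2 < (r+1)·ε. -/
/-- The set of points of the finite set `A` nearest to `x`:
`q_A(x) = {a ∈ A : d(x,a) = d(x,A)}`. -/
def nearestPoints {X : Type*} [MetricSpace X] (A : Finset X) (x : X) : Set X :=
  {a | a ∈ A ∧ dist x a = Metric.infDist x (A : Set X)}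

/-- If `x` is a witness for `a_0, …, a_r` at scale `ε'`, i.e.
`Σ_j d(x,a_j) < (r+1)·ε'`, and `b_j ∈ q_A(a_j)` for each `j`, then
`Σ_j d(x,b_j) < (r+1)·(ε+γ)/2 < (r+1)·ε`. -/
theorem witness_sum_dist_lt {X : Type*} [MetricSpace X]
    (A : Finset X) (hA : A.Nonempty) (γ ε ε' : ℝ)
    (hγ : ∀ x : X, Metric.infDist x (A : Set X) ≤ γ)
    (hγε : γ < ε) (hε' : 0 < ε') (hadj : ε' < (ε - γ) / 2)
    (r : ℕ) (x : X) (a b : Fin (r + 1) → X)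
    (hsum : ∑ j, dist x (a j) < (r + 1 : ℝ) * ε')
    (hb : ∀ j, b j ∈ nearestPoints A (a j)) :
    ∑ j, dist x (b j) < (r + 1 : ℝ) * ((ε + γ) / 2) ∧
      (r + 1 : ℝ) * ((ε + γ) / 2) < (r + 1 : ℝ) * ε := by
  have hr : (0 : ℝ) < r + 1 := by positivity
  have hdist (j : Fin (r + 1)) : dist x (b j) ≤ dist x (a j) + γ := by
    have h := hγ (a j)
    rw [← (hb j).2] at h
    linarith [dist_triangle x (a j) (b j)]
  refine ⟨?_, by gcongr; linarith⟩
  calc ∑ j, dist x (b j) ≤ ∑ j, (dist x (a j) + γ) := Finset.sum_le_sum fun j _ => hdist j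
    _ = ∑ j, dist x (a j) + (r + 1 : ℝ) * γ := by simp [Finset.sum_add_distrib]
    _ < (r + 1 : ℝ) * ε' + (r + 1 : ℝ) * γ := by gcongr
    _ = (r + 1 : ℝ) * (ε' + γ) := by ring
    _ < (r + 1 : ℝ) * ((ε + γ) / 2) := by gcongr; linarith
end

section
/- For every subset U ⊆ A, the set {x ∈ X : q_A(x) ⊆ U} is open in X. Equivalently, the nearest-point map q_A from X to the hyperspace of nonempty subsets of A equipped with the upper semifinite topology (in which a family of nonempty subsets of A is open exactly when it is closed under passing to nonempty subsets) is continuous. -/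
/-- The upper semifinite topology on subsets of `α`: a family of sets is open exactly when
it is closed under passing to nonempty subsets (it is down-closed among nonempty sets). -/
def upperSemifinite (α : Type*) : TopologicalSpace (Set α) where
  IsOpen 𝒰 := ∀ C ∈ 𝒰, ∀ D : Set α, D ⊆ C → D.Nonempty → D ∈ 𝒰
  isOpen_univ := fun C _ D _ _ => Set.mem_univ D
  isOpen_inter := fun s t hs ht C hC D hD hne =>
    ⟨hs C hC.1 D hD hne, ht C hC.2 D hD hne⟩
  isOpen_sUnion := fun s hs C hC D hD hne => by
    obtain ⟨t, hts, hCt⟩ := hC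
    exact ⟨t, hts, hs t hts C hCt D hD hne⟩

theorem nearestPoints_nonempty {X : Type*} [MetricSpace X] {A : Finset X} (hA : A.Nonempty)
    (x : X) : (nearestPoints A x).Nonempty := by
  obtain ⟨a, ha, h⟩ := A.finite_toSet.isCompact.exists_infDist_eq_dist
    (Finset.coe_nonempty.2 hA) x
  exact ⟨a, Finset.mem_coe.1 ha, h.symm⟩

open Filter Topology in
theorem eventually_nearestPoints_subset {X : Type*} [MetricSpace X] (A : Finset X) (x : X) :
    ∀ᶠ y in 𝓝 x, nearestPoints A y ⊆ nearestPoints A x := by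
  have h : ∀ᶠ y in 𝓝 x, ∀ a ∈ A, a ∈ nearestPoints A y → a ∈ nearestPoints A x := by
    rw [Filter.eventually_all_finset]
    intro a ha
    by_cases hx : a ∈ nearestPoints A x
    · exact Eventually.of_forall fun _ _ => hx
    have hne : dist x a ≠ Metric.infDist x (A : Set X) := fun h => hx ⟨ha, h⟩
    have hd : Continuous fun y : X => dist y a := by fun_prop
    filter_upwards [(hd.continuousAt.ne_iff_eventually_ne
      (Metric.continuous_infDist_pt (A : Set X)).continuousAt).1 hne] with y hy hay
    exact absurd hay.2 hy
  filter_upwards [h] with y hy a ha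
  exact hy a ha.1 ha

/-- For every subset `U ⊆ A`, the set `{x : q_A(x) ⊆ U}` is open in `X`; equivalently,
the nearest-point map `q_A : X → 2^A_u` is continuous for the upper semifinite topology. -/
theorem nearestPoints_continuous {X : Type*} [MetricSpace X]
    (A : Finset X) (hA : A.Nonempty) :
    (∀ U : Set X, U ⊆ (A : Set X) → IsOpen {x : X | nearestPoints A x ⊆ U}) ∧
    @Continuous X (Set X) _ (upperSemifinite X) (fun x => nearestPoints A x) := by
  refine ⟨fun U _ => isOpen_iff_mem_nhds.2 fun x hx => ?_, ?_⟩
  · filter_upwards [eventually_nearestPoints_subset A x] with y hy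
    exact hy.trans hx
  · refine @Continuous.mk _ _ _ (upperSemifinite X) _ fun 𝒰 h𝒰 =>
      isOpen_iff_mem_nhds.2 fun x hx => ?_
    filter_upwards [eventually_nearestPoints_subset A x] with y hy
    exact h𝒰 _ hx _ hy (nearestPoints_nonempty hA y)
end

section
/- Let (X,d) be a compact metric space and let 2^X_u denote the set of nonempty closed subsets of X with the upper semifinite topology, generated by the sets B(U) = {C : C ⊆ U} for U open in X. Then: (i) for every ε > 0 the set U_ε = {C ∈ 2^X_u : diam C < ε} is open in 2^X_u; and (ii) for every open set 𝒪 of 2^X_u containing every singleton {x}, x ∈ X, there exists ε > 0 with U_ε ⊆ 𝒪. Hence the family {U_ε}_{ε>0} is a base of open neighborhoods of the canonical copy of X (the set of singletons) inside 2^X_u. -/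
/-- The hyperspace `2^X` of nonempty closed subsets of a topological space `X`. -/
def Hyperspace (X : Type*) [TopologicalSpace X] : Type _ :=
  {C : Set X // C.Nonempty ∧ IsClosed C}

/-- The upper semifinite topology on the hyperspace `2^X`, generated by the sets
`B(U) = {C : C ⊆ U}` for `U` open in `X`. -/
def upperSemifiniteTopology (X : Type*) [TopologicalSpace X] :
    TopologicalSpace (Hyperspace X) :=
  TopologicalSpace.generateFrom
    {𝒰 : Set (Hyperspace X) | ∃ U : Set X, IsOpen U ∧ 𝒰 = {C : Hyperspace X | C.1 ⊆ U}}

/-- The sets `B(U)` form a base of the upper semifinite topology: a family is open if and only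
if each of its members `C` has an open neighborhood `U` all of whose closed subsets belong to
the family. -/
theorem isOpen_upperSemifiniteTopology_iff {X : Type*} [TopologicalSpace X]
    {𝒪 : Set (Hyperspace X)} :
    @IsOpen (Hyperspace X) (upperSemifiniteTopology X) 𝒪 ↔
      ∀ C ∈ 𝒪, ∃ U : Set X, IsOpen U ∧ C.1 ⊆ U ∧ ∀ D : Hyperspace X, D.1 ⊆ U → D ∈ 𝒪 := by
  constructor
  · intro h
    change TopologicalSpace.GenerateOpen _ 𝒪 at h
    induction h with
    | basic 𝒰 h𝒰 =>
      obtain ⟨U, hU, rfl⟩ := h𝒰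
      exact fun C hC => ⟨U, hU, hC, fun D hD => hD⟩
    | univ => exact fun C _ => ⟨Set.univ, isOpen_univ, Set.subset_univ _, fun D _ => Set.mem_univ D⟩
    | inter 𝒮 𝒯 _ _ ihS ihT =>
      rintro C ⟨hCS, hCT⟩
      obtain ⟨U, hU, hCU, hUS⟩ := ihS C hCS
      obtain ⟨V, hV, hCV, hVT⟩ := ihT C hCT
      exact ⟨U ∩ V, hU.inter hV, Set.subset_inter hCU hCV, fun D hD =>
        ⟨hUS D (hD.trans Set.inter_subset_left), hVT D (hD.trans Set.inter_subset_right)⟩⟩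
    | sUnion 𝒮 _ ih =>
      rintro C ⟨𝒯, h𝒯, hC⟩
      obtain ⟨U, hU, hCU, hUT⟩ := ih 𝒯 h𝒯 C hC
      exact ⟨U, hU, hCU, fun D hD => ⟨𝒯, h𝒯, hUT D hD⟩⟩
  · intro h
    let _ : TopologicalSpace (Hyperspace X) := upperSemifiniteTopology X
    refine isOpen_iff_forall_mem_open.2 fun C hC => ?_
    obtain ⟨U, hU, hCU, hU𝒪⟩ := h C hC
    exact ⟨{D | D.1 ⊆ U}, hU𝒪, TopologicalSpace.isOpen_generateFrom_of_mem ⟨U, hU, rfl⟩, hCU⟩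

/-- For a compact metric space `X`: (i) each `U_ε = {C ∈ 2^X_u : diam C < ε}` is open in the
upper semifinite topology, and (ii) every open set of `2^X_u` containing all singletons
contains some `U_ε`.  Hence `{U_ε}_{ε>0}` is a base of open neighborhoods of the canonical
copy of `X` inside `2^X_u`. -/
theorem upperSemifinite_diam_basis (X : Type*) [MetricSpace X] [CompactSpace X] :
    (∀ ε : ℝ, 0 < ε →
      @IsOpen (Hyperspace X) (upperSemifiniteTopology X)
        {C : Hyperspace X | Metric.diam C.1 < ε}) ∧
    (∀ 𝒪 : Set (Hyperspace X), @IsOpen (Hyperspace X) (upperSemifiniteTopology X) 𝒪 →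
      (∀ x : X, (⟨{x}, Set.singleton_nonempty x, isClosed_singleton⟩ : Hyperspace X) ∈ 𝒪) →
      ∃ ε : ℝ, 0 < ε ∧ {C : Hyperspace X | Metric.diam C.1 < ε} ⊆ 𝒪) := by
  refine ⟨fun ε _ => ?_, fun 𝒪 h𝒪 hx => ?_⟩
  · refine isOpen_upperSemifiniteTopology_iff.2 fun C (hC : Metric.diam C.1 < ε) => ?_
    have hδ : 0 < (ε - Metric.diam C.1) / 3 := by linarith
    refine ⟨Metric.thickening _ C.1, Metric.isOpen_thickening,
      Metric.self_subset_thickening hδ _, fun D hD => ?_⟩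
    have h₁ := Metric.diam_mono hD (isCompact_univ.isBounded.subset (Set.subset_univ _))
    have h₂ := Metric.diam_thickening_le C.1 hδ.le
    change Metric.diam D.1 < ε
    linarith
  · choose U hUo hxU hU using fun x => isOpen_upperSemifiniteTopology_iff.1 h𝒪 _ (hx x)
    obtain ⟨δ, hδ, hball⟩ := lebesgue_number_lemma_of_metric isCompact_univ hUo
      fun x _ => Set.mem_iUnion.2 ⟨x, hxU x rfl⟩
    refine ⟨δ, hδ, fun C (hC : Metric.diam C.1 < δ) => ?_⟩
    obtain ⟨y, hy⟩ := C.2.1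
    obtain ⟨x, hyx⟩ := hball y (Set.mem_univ y)
    refine hU x C fun z hz => hyx ?_
    have hb : Bornology.IsBounded C.1 := isCompact_univ.isBounded.subset (Set.subset_univ _)
    exact (Metric.dist_le_diam_of_mem hb hz hy).trans_lt hC
end

section
/- Every movable inverse sequence of groups has the Mittag-Leffler property. That is, if for every n ∈ ℕ there exists n' ≥ n such that for every n'' ≥ n there is a group homomorphism r : H_{n'} → H_{n''} with q_{n,n'} = q_{n,n''} ∘ r, then for every n ∈ ℕ there exists m ≥ n such that q_{n,r'}(H_{r'}) = q_{n,m}(H_m) for every r' ≥ m. -/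
/-- The composite bonding homomorphism `q_{n,n+k} = f_n ∘ ⋯ ∘ f_{n+k-1} : H_{n+k} → H_n`
of an inverse sequence of groups `(H_n, f_n)`. -/
def bondingMap {H : ℕ → Type*} [∀ i, Group (H i)] (f : ∀ i, H (i + 1) →* H i)
    (n : ℕ) : ∀ k : ℕ, H (n + k) →* H n
  | 0 => MonoidHom.id (H n)
  | (k + 1) => (bondingMap f n k).comp (f (n + k))

theorem bondingMap_range_antitone {H : ℕ → Type*} [∀ i, Group (H i)]
    (f : ∀ i, H (i + 1) →* H i) (n : ℕ) :
    Antitone fun k => (bondingMap f n k).range :=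
  antitone_nat_of_succ_le fun k => by
    rintro _ ⟨x, rfl⟩
    exact ⟨f (n + k) x, rfl⟩

/-- Every movable inverse sequence of groups has the Mittag-Leffler property:
if every `n` admits `n' = n + k ≥ n` such that for every `n'' = n + j ≥ n` there is a
homomorphism `r : H_{n'} → H_{n''}` with `q_{n,n'} = q_{n,n''} ∘ r`, then every `n`
admits `m = n + k ≥ n` with `q_{n,r'}(H_{r'}) = q_{n,m}(H_m)` for every `r' = m + j ≥ m`. -/
theorem mittagLeffler_of_movable {H : ℕ → Type*} [∀ i, Group (H i)]
    (f : ∀ i, H (i + 1) →* H i)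
    (hmov : ∀ n : ℕ, ∃ k : ℕ, ∀ j : ℕ, ∃ r : H (n + k) →* H (n + j),
      bondingMap f n k = (bondingMap f n j).comp r) :
    ∀ n : ℕ, ∃ k : ℕ, ∀ j : ℕ,
      (bondingMap f n (k + j)).range = (bondingMap f n k).range := by
  intro n
  obtain ⟨k, hk⟩ := hmov n
  refine ⟨k, fun j => le_antisymm (bondingMap_range_antitone f n (Nat.le_add_right k j)) ?_⟩
  obtain ⟨r, hr⟩ := hk (k + j)
  rw [hr]
  rintro _ ⟨x, rfl⟩
  exact ⟨r x, rfl⟩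
end

section
/- The inverse limit of the Hawaiian homology sequence (G_k, f_k) is isomorphic, as an additive group, to the full product ∏_{i∈ℕ} ℤ (equivalently, to the group of all functions ℕ → ℤ under pointwise addition). Explicitly, threads are in bijection with sequences (x_i)_{i∈ℕ} ∈ ℤ^ℕ via s_k(i) = x_i for 0 ≤ i ≤ 3k and s_k(3k+1) = s_k(3k+2) = s_k(3k+3) = x_{3k+1}. -/
/-- The bonding homomorphism `f_k : G_{k+1} → G_k` of the Hawaiian homology sequence,
where `G_k = (Fin (3k+4) → ℤ)`: `(f_k h)(i) = h(i)` for `i ≤ 3k` and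
`(f_k h)(3k+1) = (f_k h)(3k+2) = (f_k h)(3k+3) = h(3k+1)`. -/
def hawF (k : ℕ) : (Fin (3 * (k + 1) + 4) → ℤ) →+ (Fin (3 * k + 4) → ℤ) where
  toFun h := fun i =>
    if (i : ℕ) ≤ 3 * k then h ⟨(i : ℕ), by omega⟩ else h ⟨3 * k + 1, by omega⟩
  map_zero' := by
    funext i
    by_cases hi : (i : ℕ) ≤ 3 * k <;> simp [hi]
  map_add' a b := by
    funext i
    by_cases hi : (i : ℕ) ≤ 3 * k <;> simp [hi]

/-- The inverse limit of the Hawaiian homology sequence: the subgroup of threads. -/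
def hawLimit : AddSubgroup (∀ k : ℕ, Fin (3 * k + 4) → ℤ) where
  carrier := {s | ∀ k : ℕ, hawF k (s (k + 1)) = s k}
  zero_mem' := fun k => by simp
  add_mem' := fun {a b} ha hb k => by simp [ha k, hb k]
  neg_mem' := fun {a} ha k => by simp [ha k]

theorem hawF_apply (k : ℕ) (h : Fin (3 * (k + 1) + 4) → ℤ) (i : Fin (3 * k + 4)) :
    hawF k h i = h ⟨min (i : ℕ) (3 * k + 1), by omega⟩ := by
  change (if (i : ℕ) ≤ 3 * k then h ⟨(i : ℕ), _⟩ else h ⟨3 * k + 1, _⟩) = _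
  split_ifs with hi
  · congr 2
    omega
  · congr 2
    omega

/-- The coordinates of a thread with index at most `3k` are stable from level `k` on. -/
theorem hawLimit_stable (s : hawLimit) {k m i : ℕ} (hi : i ≤ 3 * k) (hkm : k ≤ m) :
    s.1 m ⟨i, by omega⟩ = s.1 k ⟨i, by omega⟩ := by
  induction m, hkm using Nat.le_induction with
  | base => rfl
  | succ m hkm ih =>
    rw [← ih, ← s.2 m, hawF_apply]
    exact congrArg _ (Fin.ext (by simp only; omega))

/-- A thread is determined by its diagonal coordinates. -/
theorem hawLimit_apply (s : hawLimit) (k : ℕ) (i : Fin (3 * k + 4)) :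
    s.1 k i = s.1 (min (i : ℕ) (3 * k + 1)) ⟨min (i : ℕ) (3 * k + 1), by omega⟩ := by
  rw [← s.2 k, hawF_apply]
  rcases le_total (k + 1) (min (i : ℕ) (3 * k + 1)) with h | h
  · exact (hawLimit_stable s (by omega) h).symm
  · exact hawLimit_stable s (by omega) h

/-- The thread with coordinates `s_k(i) = x_{min(i, 3k+1)}`. -/
def hawThread (x : ℕ → ℤ) : hawLimit :=
  ⟨fun k i => x (min (i : ℕ) (3 * k + 1)), fun k => by
    funext i
    rw [hawF_apply]
    exact congrArg x (by simp only; omega)⟩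

/-- The isomorphism sending a thread to its sequence of diagonal coordinates. -/
def hawLimitEquiv : hawLimit ≃+ (ℕ → ℤ) where
  toFun s i := s.1 i ⟨i, by omega⟩
  invFun := hawThread
  left_inv s := by
    ext k i
    exact (hawLimit_apply s k i).symm
  right_inv x := by
    funext i
    change x (min i (3 * i + 1)) = x i
    congr 1
    omega
  map_add' _ _ := rfl

theorem hawLimit_apply_eq (s : hawLimit) (k : ℕ) (i : Fin (3 * k + 4)) {j : ℕ}
    (hj : min (i : ℕ) (3 * k + 1) = j) : s.1 k i = hawLimitEquiv s j := by
  subst hj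
  exact hawLimit_apply s k i

/-- The inverse limit of the Hawaiian homology sequence `(G_k, f_k)` is isomorphic, as an
additive group, to the full product `∏_{i∈ℕ} ℤ`; explicitly, threads `s` correspond to
sequences `x : ℕ → ℤ` via `s_k(i) = x_i` for `0 ≤ i ≤ 3k` and
`s_k(3k+1) = s_k(3k+2) = s_k(3k+3) = x_{3k+1}`. -/
theorem hawLimit_equiv_pi :
    ∃ e : hawLimit ≃+ (ℕ → ℤ),
      ∀ s : hawLimit, ∀ k : ℕ,
        (∀ i : Fin (3 * k + 4), (i : ℕ) ≤ 3 * k → (s : ∀ k, Fin (3 * k + 4) → ℤ) k i = e s i) ∧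
        (s : ∀ k, Fin (3 * k + 4) → ℤ) k ⟨3 * k + 1, by omega⟩ = e s (3 * k + 1) ∧
        (s : ∀ k, Fin (3 * k + 4) → ℤ) k ⟨3 * k + 2, by omega⟩ = e s (3 * k + 1) ∧
        (s : ∀ k, Fin (3 * k + 4) → ℤ) k ⟨3 * k + 3, by omega⟩ = e s (3 * k + 1) := by
  refine ⟨hawLimitEquiv, fun s k => ⟨fun i hi => ?_, ?_, ?_, ?_⟩⟩
  · exact hawLimit_apply_eq s k i (by omega)
  all_goals exact hawLimit_apply_eq s k _ (by simp only; omega)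
end
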